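/- Define the one-dimensional mixture kernel κ_M(u,t) = 15/8 − (1/4)|u − 1/2| − (1/4)|t − 1/2| − (3/4)|u − t| + (1/2)|u − t|² for u, t ∈ [0,1], and the q-dimensional mixture kernel K_M(u,t) = Π_{d=1}^q κ_M(u_d, t_d) for u, t ∈ [0,1]^q. Let u_1, …, u_{r} ∈ [0,1]^q with r ≥ 1, and define the squared mixture discrepancy by the analytic expression D_M² = ∫_{[0,1]^q}∫_{[0,1]^q} K_M(u,t) du dt − (2/r) Σ_{j=1}^{r} ∫_{[0,1]^q} K_M(u, u_j) du + (1/r²) Σ_{j=1}^{r} Σ_{k=1}^{r} K_M(u_j, u_k), where integrals are with respect to the q-fold product of Lebesgue measure on [0,1]^q. Then D_M² = (19/12)^q − (2/r) Σ_{j=1}^{r} Π_{d=1}^q [5/3 − (1/4)|u_{jd} − 1/2| − (1/4)(u_{jd} − 1/2)²] + (1/r²) Σ_{j=1}^{r} Σ_{k=1}^{r} Π_{d=1}^q (15/8 − (1/4)|u_{jd} − 1/2| − (1/4)|u_{kd} − 1/2| − (3/4)|u_{jd} − u_{kd}| + (1/2)|u_{jd} − u_{kd}|²). -/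

import Mathlib

open MeasureTheory
open scoped BigOperators

/-- The one-dimensional factor of the mixture-discrepancy kernel. -/
noncomputable def mixKernel (u t : ℝ) : ℝ :=
  15 / 8 - (1 / 4) * |u - 1 / 2| - (1 / 4) * |t - 1 / 2| - (3 / 4) * |u - t|
    + (1 / 2) * |u - t| ^ 2

/-- The `q`-dimensional mixture-discrepancy kernel. -/
noncomputable def mixKernelQ (q : ℕ) (u t : Fin q → ℝ) : ℝ :=
  ∏ d, mixKernel (u d) (t d)

/-- The `q`-fold product of Lebesgue measure restricted to `[0,1]^q`. -/
noncomputable def unifCube (q : ℕ) : Measure (Fin q → ℝ) :=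
  Measure.pi fun _ : Fin q => volume.restrict (Set.Icc 0 1)

theorem aux_abs (c : ℝ) (hc : c ∈ Set.Icc (0 : ℝ) 1) :
    ∫ u in (0 : ℝ)..1, |u - c| = (c ^ 2 + (1 - c) ^ 2) / 2 := by
  have hi : ∀ a b : ℝ, IntervalIntegrable (fun u : ℝ => |u - c|) volume a b := fun a b =>
    Continuous.intervalIntegrable (by fun_prop) a b
  rw [← intervalIntegral.integral_add_adjacent_intervals (hi 0 c) (hi c 1)]
  have h1 : ∫ u in (0 : ℝ)..c, |u - c| = ∫ u in (0 : ℝ)..c, (c - u) := by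
    apply intervalIntegral.integral_congr
    intro u hu
    rw [Set.uIcc_of_le hc.1] at hu
    simp only
    rw [abs_of_nonpos (by linarith [hu.2])]
    ring
  have h2 : ∫ u in c..1, |u - c| = ∫ u in c..1, (u - c) := by
    apply intervalIntegral.integral_congr
    intro u hu
    rw [Set.uIcc_of_le hc.2] at hu
    simp only
    rw [abs_of_nonneg (by linarith [hu.1])]
  rw [h1, h2, intervalIntegral.integral_sub (by simp) (by simp),
    intervalIntegral.integral_sub (by simp) (by simp)]
  simp only [integral_id, intervalIntegral.integral_const, smul_eq_mul]
  ring

theorem aux_sq (c : ℝ) : ∫ u in (0 : ℝ)..1, (u - c) ^ 2 = 1 / 3 - c + c ^ 2 := by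
  rw [intervalIntegral.integral_comp_sub_right (fun x => x ^ 2) c, integral_pow]
  norm_num
  ring

theorem aux_A1 (c : ℝ) (hc : c ∈ Set.Icc (0 : ℝ) 1) :
    ∫ u in Set.Icc (0 : ℝ) 1, mixKernel u c
      = 5 / 3 - (1 / 4) * |c - 1 / 2| - (1 / 4) * (c - 1 / 2) ^ 2 := by
  rw [integral_Icc_eq_integral_Ioc, ← intervalIntegral.integral_of_le zero_le_one]
  unfold mixKernel
  simp only [sq_abs]
  have h : ∀ f : ℝ → ℝ, Continuous f → IntervalIntegrable f volume 0 1 :=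
    fun f hf => hf.intervalIntegrable 0 1
  rw [intervalIntegral.integral_add (h _ (by fun_prop)) (h _ (by fun_prop)),
    intervalIntegral.integral_sub (h _ (by fun_prop)) (h _ (by fun_prop)),
    intervalIntegral.integral_sub (h _ (by fun_prop)) (h _ (by fun_prop)),
    intervalIntegral.integral_sub (h _ (by fun_prop)) (h _ (by fun_prop))]
  simp only [intervalIntegral.integral_const_mul, intervalIntegral.integral_const, smul_eq_mul]
  rw [aux_abs c hc, aux_sq, aux_abs (1 / 2) (by norm_num)]
  ring

theorem aux_A0 :
    ∫ c in Set.Icc (0 : ℝ) 1, (5 / 3 - (1 / 4) * |c - 1 / 2| - (1 / 4) * (c - 1 / 2) ^ 2)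
      = 19 / 12 := by
  rw [integral_Icc_eq_integral_Ioc, ← intervalIntegral.integral_of_le zero_le_one]
  have h : ∀ f : ℝ → ℝ, Continuous f → IntervalIntegrable f volume 0 1 :=
    fun f hf => hf.intervalIntegrable 0 1
  rw [intervalIntegral.integral_sub (h _ (by fun_prop)) (h _ (by fun_prop)),
    intervalIntegral.integral_sub (h _ (by fun_prop)) (h _ (by fun_prop))]
  simp only [intervalIntegral.integral_const_mul, intervalIntegral.integral_const, smul_eq_mul]
  rw [aux_sq, aux_abs (1 / 2) (by norm_num)]
  norm_num

theorem mixKernel_symm (u t : ℝ) : mixKernel u t = mixKernel t u := by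
  unfold mixKernel
  rw [abs_sub_comm u t]
  ring

theorem aux_prod (q : ℕ) (t : Fin q → ℝ) :
    ∫ u, mixKernelQ q u t ∂(unifCube q) = ∏ d, ∫ u in Set.Icc (0 : ℝ) 1, mixKernel u (t d) := by
  unfold mixKernelQ unifCube
  exact integral_fintype_prod_eq_prod (fun d u => mixKernel u (t d))

theorem aux_double (q : ℕ) :
    ∫ u, ∫ t, mixKernelQ q u t ∂(unifCube q) ∂(unifCube q) = (19 / 12 : ℝ) ^ q := by
  have h : ∀ u, ∫ t, mixKernelQ q u t ∂(unifCube q)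
      = ∏ d, ∫ t in Set.Icc (0 : ℝ) 1, mixKernel t (u d) := by
    intro u
    rw [← aux_prod]
    congr 1
    funext t
    exact Finset.prod_congr rfl fun d _ => mixKernel_symm _ _
  simp only [h]
  unfold unifCube
  rw [integral_fintype_prod_eq_prod
    (fun (_ : Fin q) c => ∫ t in Set.Icc (0 : ℝ) 1, mixKernel t c),
    setIntegral_congr_fun measurableSet_Icc (fun c hc => aux_A1 c hc), aux_A0]
  rw [Finset.prod_const, Finset.card_univ, Fintype.card_fin]

/-- Closed form of the mixture discrepancy: the analytic three-term expression for the
squared mixture discrepancy of a design `{u_1,…,u_r} ⊂ [0,1]^q` equals the fully explicit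
closed form obtained by Fubini factorization and the one-dimensional marginal integrals. -/
theorem mixture_discrepancy_closed_form (q r : ℕ) (hr : 1 ≤ r)
    (U : Fin r → (Fin q → ℝ)) (hU : ∀ j d, U j d ∈ Set.Icc (0 : ℝ) 1) :
    (∫ u, ∫ t, mixKernelQ q u t ∂(unifCube q) ∂(unifCube q))
      - (2 / (r : ℝ)) * ∑ j, (∫ u, mixKernelQ q u (U j) ∂(unifCube q))
      + (1 / (r : ℝ) ^ 2) * ∑ j, ∑ k, mixKernelQ q (U j) (U k) =
    (19 / 12 : ℝ) ^ q
      - (2 / (r : ℝ)) * ∑ j, ∏ d,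
          (5 / 3 - (1 / 4) * |U j d - 1 / 2| - (1 / 4) * (U j d - 1 / 2) ^ 2)
      + (1 / (r : ℝ) ^ 2) * ∑ j, ∑ k, ∏ d,
          (15 / 8 - (1 / 4) * |U j d - 1 / 2| - (1 / 4) * |U k d - 1 / 2|
            - (3 / 4) * |U j d - U k d| + (1 / 2) * |U j d - U k d| ^ 2) := by
  have h : ∀ j, ∫ u, mixKernelQ q u (U j) ∂(unifCube q) = ∏ d,
      (5 / 3 - (1 / 4) * |U j d - 1 / 2| - (1 / 4) * (U j d - 1 / 2) ^ 2) := by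
    intro j
    rw [aux_prod]
    exact Finset.prod_congr rfl fun d _ => aux_A1 _ (hU j d)
  rw [aux_double]
  simp only [h]
  rfl
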